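/- Let F, p, K = F(√−p), the Shintani set R_{F,p}, the action ∗, and the Hecke character χ be as in the context. Then χ is constant along Shintani cycles: for every r ∈ R_{F,p} and every i ≥ 0, χ((p·(ε_F^i ∗ r))·O_F) = χ((p·r)·O_F). -/

import Mathlib

set_option synthInstance.maxHeartbeats 1000000
set_option maxHeartbeats 1000000

open NumberField IntermediateField

/-- `(r₁, r₂)` are the coordinates of an element `r₁ + r₂·ε` of the Shintani set
`R_{F,p} = { r₁ + r₂·ε ∈ (1/p)O_F : r₁ ∈ ℚ ∩ (0,1], r₂ ∈ ℚ ∩ [0,1) }`. -/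
def inShintani (F : IntermediateField ℚ ℂ) [NumberField F] (p : ℕ) (ε : ℝ)
    (r : ℚ × ℚ) : Prop :=
  0 < r.1 ∧ r.1 ≤ 1 ∧ 0 ≤ r.2 ∧ r.2 < 1 ∧
    ∃ y : NumberField.RingOfIntegers F,
      ((y : F) : ℂ) = (p : ℂ) * ((r.1 : ℂ) + (r.2 : ℂ) * (ε : ℂ))

/-- In coordinates, the action of `ε` on the Shintani set is
`ε ∗ (r₁ + r₂·ε) = (1 − r₂) + {r₁ + r₂·Tr_{F/ℚ}(ε)}·ε`, where `T = Tr_{F/ℚ}(ε)`. -/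
def shintaniAct (T : ℤ) (r : ℚ × ℚ) : ℚ × ℚ :=
  (1 - r.2, Int.fract (r.1 + r.2 * (T : ℚ)))

/-- The principal ideal of `O_F` generated by the element of `O_F` whose image in `ℂ`
is `v`. -/
noncomputable def idealOf (F : IntermediateField ℚ ℂ) [NumberField F] (v : ℂ) :
    Ideal (NumberField.RingOfIntegers F) :=
  Ideal.span {y : NumberField.RingOfIntegers F | ((y : F) : ℂ) = v}

lemma ff_odd {k : Type*} [Field k] [Fintype k] (p m : ℕ) [Fact p.Prime] (hp4 : p % 4 = 3)
    (hm : 4 * m = p + 1) (hpk : (p : k) ≠ 0) (h2 : ringChar k ≠ 2) :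
    (∃ c : k, c ^ 2 - c + m = 0) ↔ legendreSym p (Fintype.card k : ℤ) = 1 := by
  classical
  have h2k : (2 : k) ≠ 0 := Ring.two_ne_zero h2
  have hmk : (4 : k) * m = p + 1 := by exact_mod_cast congrArg (Nat.cast : ℕ → k) hm
  have h1 : (∃ c : k, c ^ 2 - c + m = 0) ↔ IsSquare (-(p : k)) := by
    constructor
    · rintro ⟨c, hc⟩
      exact ⟨2 * c - 1, by linear_combination -4 * hc + hmk⟩
    · rintro ⟨s, hs⟩
      refine ⟨(1 + s) / 2, ?_⟩
      have h4 : (4 : k) ≠ 0 := by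
        have := mul_ne_zero h2k h2k
        norm_num at this; exact this
      have : (m : k) = (p + 1) / 4 := by rw [eq_div_iff h4]; linear_combination hmk
      rw [this]
      have h44 : (4:k) = 2 * 2 := by norm_num
      rw [h44]
      field_simp
      linear_combination (-1) * hs
  rw [h1, ← quadraticChar_one_iff_isSquare (neg_ne_zero.mpr hpk)]
  have hp2 : p ≠ 2 := by omega
  have hne : ringChar k ≠ p := by
    rintro h; apply hpk; rw [← h]; simp
  have hm1 : quadraticChar (ZMod p) (-1) = -1 := by
    rw [quadraticChar_neg_one (by rwa [ZMod.ringChar_zmod_n]), ZMod.card]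
    exact ZMod.χ₄_nat_three_mod_four hp4
  rw [← neg_one_mul, map_mul, quadraticChar_neg_one h2, quadraticChar_odd_prime h2 hp2 hne, map_mul]
  have hodd : Fintype.card k % 2 = 1 := FiniteField.odd_card_of_char_ne_two h2
  have h3 : legendreSym p (Fintype.card k : ℤ) = quadraticChar (ZMod p) (Fintype.card k : ZMod p) := by
    simp [legendreSym]
  rw [h3]
  have h4 : Fintype.card k % 4 = 1 ∨ Fintype.card k % 4 = 3 := by omega
  rcases h4 with h4 | h4
  · rw [ZMod.χ₄_nat_one_mod_four h4]; simp
  · rw [ZMod.χ₄_nat_three_mod_four h4]; simp [hm1]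

lemma ff_two {k : Type*} [Field k] [Fintype k] (p m : ℕ) [Fact p.Prime] (hp4 : p % 4 = 3)
    (hm : 4 * m = p + 1) (h2 : ringChar k = 2) :
    (∃ c : k, c ^ 2 - c + m = 0) ↔ legendreSym p (Fintype.card k : ℤ) = 1 := by
  classical
  have hch : CharP k 2 := ringChar.of_eq h2
  have h20 : (2 : k) = 0 := by exact_mod_cast CharP.cast_eq_zero k 2
  obtain ⟨n, _, hn⟩ := FiniteField.card k 2
  have hp2 : p ≠ 2 := by omega
  have hl : legendreSym p (Fintype.card k : ℤ) = (legendreSym p 2) ^ (n : ℕ) := by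
    rw [hn]; push_cast
    induction (n : ℕ) with
    | zero => simp
    | succ j ih => rw [pow_succ, legendreSym.mul, ih, pow_succ]
  rw [hl, legendreSym.at_two hp2, ZMod.χ₈_nat_eq_if_mod_eight]
  have h8 : p % 8 = 3 ∨ p % 8 = 7 := by omega
  rcases h8 with h8 | h8
  · have hmo : m = 2 * (m / 2) + 1 := by omega
    have hmk : (m : k) = 1 := by rw [hmo]; push_cast; rw [h20]; ring
    have : (if p % 2 = 0 then (0:ℤ) else if p % 8 = 1 ∨ p % 8 = 7 then 1 else -1) = -1 := by
      rw [if_neg (by omega), if_neg (by omega)]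
    rw [this, hmk]
    have e1 : (-1 : ℤ) ^ (n : ℕ) = 1 ↔ Even (n : ℕ) := neg_one_pow_eq_one_iff_even (by norm_num)
    rw [e1]
    have hu : Fintype.card kˣ = 2 ^ (n : ℕ) - 1 := by rw [Fintype.card_units, hn]
    have e2 : 3 ∣ Fintype.card kˣ ↔ Even (n : ℕ) := by
      rw [hu]
      have hpos : 0 < 2 ^ (n : ℕ) := by positivity
      rcases Nat.even_or_odd' (n : ℕ) with ⟨t, ht | ht⟩
      · rw [ht]
        have : 2 ^ (2 * t) % 3 = 1 := by rw [pow_mul, Nat.pow_mod]; norm_num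
        simp; omega
      · rw [ht]
        have : 2 ^ (2 * t + 1) % 3 = 2 := by
          rw [pow_succ, pow_mul, Nat.mul_mod, Nat.pow_mod]; norm_num
        simp only [Nat.even_add_one, even_two, Even.mul_right, not_true, iff_false]
        generalize 2 ^ (2 * t + 1) = z at this
        omega
    rw [← e2]
    constructor
    · rintro ⟨c, hc⟩
      have hc3 : c ^ 3 = 1 := by linear_combination (c + 1) * hc - h20
      have hc0 : c ≠ 0 := by rintro rfl; simp at hc
      have hc1 : c ≠ 1 := by rintro rfl; simp at hc
      have : orderOf (Units.mk0 c hc0) = 3 := by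
        have : Fact (Nat.Prime 3) := ⟨by norm_num⟩
        apply orderOf_eq_prime
        · ext; simpa using hc3
        · intro h; apply hc1; simpa using congrArg Units.val h
      rw [← this]; exact orderOf_dvd_card
    · intro h
      have : Fact (Nat.Prime 3) := ⟨by norm_num⟩
      obtain ⟨x, hx⟩ := exists_prime_orderOf_dvd_card 3 h
      have hx3 : (x : k) ^ 3 = 1 := by
        have := pow_orderOf_eq_one x
        rw [hx] at this; simpa using congrArg Units.val this
      have hx1 : (x : k) - 1 ≠ 0 := by
        intro h; have : x = 1 := by ext; simpa using sub_eq_zero.mp h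
        rw [this] at hx; simp at hx
      refine ⟨x, mul_left_cancel₀ hx1 ?_⟩
      linear_combination hx3 + ((x : k) - (x:k)^2) * h20
  · have hmo : m = 2 * (m / 2) := by omega
    have hmk : (m : k) = 0 := by rw [hmo]; push_cast; rw [h20]; ring
    have : (if p % 2 = 0 then (0:ℤ) else if p % 8 = 1 ∨ p % 8 = 7 then 1 else -1) = 1 := by
      rw [if_neg (by omega), if_pos (by omega)]
    rw [this, hmk]
    simp only [one_pow, iff_true]
    exact ⟨0, by simp⟩

lemma ff_main {k : Type*} [Field k] [Fintype k] (p m : ℕ) [Fact p.Prime] (hp4 : p % 4 = 3)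
    (hm : 4 * m = p + 1) (hpk : (p : k) ≠ 0) :
    (∃ c : k, c ^ 2 - c + m = 0) ↔ legendreSym p (Fintype.card k : ℤ) = 1 := by
  by_cases h2 : ringChar k = 2
  · exact ff_two p m hp4 hm h2
  · exact ff_odd p m hp4 hm hpk h2

section abstractpart
variable {F K : Type*} [Field F] [NumberField F] [Field K] [NumberField K] [Algebra F K]

lemma comap_eq_of_le (q : Ideal (𝓞 F)) (hq : q.IsPrime) (hq0 : q ≠ ⊥) (P : Ideal (𝓞 K))
    (hP : P.IsPrime) (hle : q.map (algebraMap (𝓞 F) (𝓞 K)) ≤ P) :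
    P.comap (algebraMap (𝓞 F) (𝓞 K)) = q := by
  have hqm : q.IsMaximal := hq.isMaximal hq0
  have h1 : q ≤ P.comap (algebraMap (𝓞 F) (𝓞 K)) := Ideal.map_le_iff_le_comap.mp hle
  have h2 : P.comap (algebraMap (𝓞 F) (𝓞 K)) ≠ ⊤ := Ideal.comap_ne_top _ hP.ne_top
  exact (hqm.eq_of_le h2 h1).symm

lemma quot_finite {F : Type*} [Field F] [NumberField F] (P : Ideal (𝓞 F)) (h : P ≠ ⊥) :
    Finite (𝓞 F ⧸ P) := Ideal.finiteQuotientOfFreeOfNeBot P h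

lemma absNorm_card {F : Type*} [Field F] [NumberField F] (P : Ideal (𝓞 F)) :
    Ideal.absNorm P = Nat.card (𝓞 F ⧸ P) := by
  rw [Ideal.absNorm_apply, Submodule.cardQuot_apply]

lemma map_ne_bot' (q : Ideal (𝓞 F)) (hq0 : q ≠ ⊥) :
    q.map (algebraMap (𝓞 F) (𝓞 K)) ≠ ⊥ := by
  rw [Ne, Ideal.map_eq_bot_iff_of_injective (FaithfulSMul.algebraMap_injective _ _)]
  exact hq0

lemma absNorm_le (q : Ideal (𝓞 F)) (hq : q.IsPrime) (hq0 : q ≠ ⊥) (P : Ideal (𝓞 K))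
    (hP : P.IsPrime) (hle : q.map (algebraMap (𝓞 F) (𝓞 K)) ≤ P) :
    Ideal.absNorm q ≤ Ideal.absNorm P ∧ (Ideal.absNorm P = Ideal.absNorm q →
      ∀ x : 𝓞 K, ∃ c : 𝓞 F, x - algebraMap (𝓞 F) (𝓞 K) c ∈ P) := by
  have hc := comap_eq_of_le q hq hq0 P hP hle
  have hP0 : P ≠ ⊥ := fun h => map_ne_bot' (K := K) q hq0 (le_bot_iff.mp (h ▸ hle))
  have := quot_finite P hP0
  have := quot_finite q hq0
  let f : 𝓞 F ⧸ q →+* 𝓞 K ⧸ P := Ideal.quotientMap P (algebraMap (𝓞 F) (𝓞 K)) hc.ge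
  have hf : Function.Injective f := Ideal.quotientMap_injective' hc.le
  rw [absNorm_card, absNorm_card]
  refine ⟨Nat.card_le_card_of_injective f hf, fun h x => ?_⟩
  have hb : Function.Bijective f := (Nat.bijective_iff_injective_and_card f).mpr ⟨hf, h.symm⟩
  obtain ⟨y, hy⟩ := hb.2 (Ideal.Quotient.mk P x)
  obtain ⟨c, rfl⟩ := Ideal.Quotient.mk_surjective y
  refine ⟨c, ?_⟩
  rw [← Ideal.Quotient.eq, ← hy]
  simp [f]

lemma trichotomy (h2 : Module.finrank F K = 2) (q : Ideal (𝓞 F)) (hq : q.IsPrime) (hq0 : q ≠ ⊥) :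
    (q.map (algebraMap (𝓞 F) (𝓞 K))).IsPrime ∨ ∃ P Q : Ideal (𝓞 K), P.IsPrime ∧ Q.IsPrime ∧
      q.map (algebraMap (𝓞 F) (𝓞 K)) = P * Q ∧ Ideal.absNorm P = Ideal.absNorm q ∧
      Ideal.absNorm Q = Ideal.absNorm q := by
  set I := q.map (algebraMap (𝓞 F) (𝓞 K)) with hI
  have hI0 : I ≠ ⊥ := map_ne_bot' q hq0
  have hr : Module.finrank (𝓞 F) (𝓞 K) = 2 := by
    rw [← h2]; exact (IsFractionRing.finrank_eq (𝓞 F) F (𝓞 K) K).symm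
  have hN : Ideal.absNorm I = Ideal.absNorm q ^ 2 := by
    rw [hI, Ideal.absNorm_algebraMap, hr]
  have hn1 : Ideal.absNorm q ≠ 1 := by rw [Ne, Ideal.absNorm_eq_one_iff]; exact hq.ne_top
  have hn0 : Ideal.absNorm q ≠ 0 := by rw [Ne, Ideal.absNorm_eq_zero_iff]; exact hq0
  have hI1 : I ≠ ⊤ := by
    rw [Ne, ← Ideal.absNorm_eq_one_iff, hN]
    intro h; exact hn1 (by simpa using h)
  obtain ⟨P, hP, hIP⟩ := Ideal.exists_le_maximal I hI1
  obtain ⟨J, hJ⟩ := Ideal.dvd_iff_le.mpr hIP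
  by_cases hJt : J = ⊤
  · left; rw [hJ, hJt, Ideal.mul_top]; exact hP.isPrime
  right
  obtain ⟨Q, hQ, hJQ⟩ := Ideal.exists_le_maximal J hJt
  have hIQ : I ≤ Q := by rw [hJ]; exact Ideal.mul_le_right.trans hJQ
  obtain ⟨J', hJ'⟩ := Ideal.dvd_iff_le.mpr hJQ
  have a1 := (absNorm_le q hq hq0 P hP.isPrime hIP).1
  have a2 := (absNorm_le q hq hq0 Q hQ.isPrime hIQ).1
  have hprod : Ideal.absNorm P * (Ideal.absNorm Q * Ideal.absNorm J') = Ideal.absNorm q ^ 2 := by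
    rw [← hN, hJ, hJ', map_mul, map_mul]
  generalize Ideal.absNorm q = n at *
  have hJ0 : Ideal.absNorm J' ≠ 0 := by
    intro h; rw [h] at hprod; simp at hprod; exact hn0 (by simpa using hprod.symm)
  have hnp : 0 < n := Nat.pos_of_ne_zero hn0
  have hPp : 0 < Ideal.absNorm P := by omega
  have hQp : 0 < Ideal.absNorm Q := by omega
  have hJp : 1 ≤ Ideal.absNorm J' := by omega
  have hQJ : n ≤ Ideal.absNorm Q * Ideal.absNorm J' := by nlinarith
  have eP : Ideal.absNorm P = n := by
    by_contra h
    have : n < Ideal.absNorm P := by omega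
    nlinarith
  have eQJ : Ideal.absNorm Q * Ideal.absNorm J' = n := by
    rw [eP, sq] at hprod; exact Nat.eq_of_mul_eq_mul_left hnp hprod
  have eQ : Ideal.absNorm Q = n := by nlinarith
  have eJ : Ideal.absNorm J' = 1 := by
    rw [eQ] at eQJ; exact Nat.eq_of_mul_eq_mul_left hnp (by rw [eQJ, mul_one])
  rw [Ideal.absNorm_eq_one_iff] at eJ
  exact ⟨P, Q, hP.isPrime, hQ.isPrime, by rw [hJ, hJ', eJ, Ideal.mul_top], eP, eQ⟩

lemma exists_conj (m : ℕ)
    (α : 𝓞 K) (hα : α ^ 2 - α + m = 0) (hαF : ∀ x : F, algebraMap F K x ≠ α)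
    (h2 : Module.finrank F K = 2) :
    ∃ σ : 𝓞 K →ₐ[𝓞 F] 𝓞 K, σ α = 1 - α := by
  have : Algebra.IsQuadraticExtension F K := { finrank_eq_two' := h2 }
  have hg : IsGalois F K := inferInstance
  have : ∃ σ : Gal(K/F), σ (α : K) ≠ α := by
    by_contra! h
    obtain ⟨x, hx⟩ := (IsGalois.mem_range_algebraMap_iff_fixed (F := F) (α : K)).mpr h
    exact hαF x hx
  obtain ⟨σ, hσ⟩ := this
  refine ⟨RingOfIntegers.mapAlgHom σ, ?_⟩
  have hk : (α : K) ^ 2 - α + m = 0 := by exact_mod_cast congrArg (algebraMap (𝓞 K) K) hα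
  have hk2 : (σ (α : K)) ^ 2 - σ α + m = 0 := by simpa using congrArg σ hk
  have : (σ (α : K) - α) * (σ α - (1 - α)) = 0 := by linear_combination hk2 - hk
  have h3 := (mul_eq_zero.mp this).resolve_left (sub_ne_zero.mpr hσ)
  apply RingOfIntegers.ext
  have h4 : ((1 - α : 𝓞 K) : K) = 1 - (α : K) := by simp
  rw [h4]
  exact sub_eq_zero.mp h3

lemma no_unique (p m : ℕ) (hm : 4 * m = p + 1)
    (α : 𝓞 K) (hα : α ^ 2 - α + m = 0) (hαF : ∀ x : F, algebraMap F K x ≠ α)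
    (h2 : Module.finrank F K = 2) (q : Ideal (𝓞 F)) (hq : q.IsPrime) (hq0 : q ≠ ⊥)
    (hpq : (p : 𝓞 F) ∉ q) (c : 𝓞 F) (P : Ideal (𝓞 K)) (hP : P.IsPrime)
    (hle : q.map (algebraMap (𝓞 F) (𝓞 K)) ≤ P)
    (huniq : ∀ Q : Ideal (𝓞 K), Q.IsPrime → q.map (algebraMap (𝓞 F) (𝓞 K)) ≤ Q → P ≤ Q)
    (hc : α - algebraMap (𝓞 F) (𝓞 K) c ∈ P) : False := by
  obtain ⟨σ, hσ⟩ := exists_conj (F := F) m α hα hαF h2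
  have h1 : P ≤ P.comap σ := by
    apply huniq _ (hP.comap σ)
    rw [Ideal.map_le_iff_le_comap] at hle ⊢
    intro x hx
    simpa using hle hx
  have h3 := h1 hc
  simp only [Ideal.mem_comap, map_sub, hσ, AlgHom.commutes] at h3
  have h4 := P.mul_mem_left (2 * α - 1) (P.sub_mem hc h3)
  have hmk : (4 : 𝓞 K) * m = p + 1 := by exact_mod_cast congrArg (Nat.cast : ℕ → 𝓞 K) hm
  have h5 : (2 * α - 1) * (α - algebraMap (𝓞 F) (𝓞 K) c - (1 - α - algebraMap (𝓞 F) (𝓞 K) c))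
      = - (p : 𝓞 K) := by linear_combination 4 * hα - hmk
  rw [h5, neg_mem_iff] at h4
  apply hpq
  rw [← comap_eq_of_le q hq hq0 P hP hle, Ideal.mem_comap]
  simpa using h4

lemma split_of_root (p m : ℕ) (hm : 4 * m = p + 1)
    (α : 𝓞 K) (hα : α ^ 2 - α + m = 0) (hαF : ∀ x : F, algebraMap F K x ≠ α)
    (h2 : Module.finrank F K = 2) (q : Ideal (𝓞 F)) (hq : q.IsPrime) (hq0 : q ≠ ⊥)
    (hpq : (p : 𝓞 F) ∉ q) (c : 𝓞 F) (hc : c ^ 2 - c + m ∈ q) :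
    ∃ P Q : Ideal (𝓞 K), P.IsPrime ∧ Q.IsPrime ∧ P ≠ Q ∧
      q.map (algebraMap (𝓞 F) (𝓞 K)) = P * Q := by
  have key : ∀ P : Ideal (𝓞 K), P.IsPrime → q.map (algebraMap (𝓞 F) (𝓞 K)) ≤ P →
      ¬ (∀ Q : Ideal (𝓞 K), Q.IsPrime → q.map (algebraMap (𝓞 F) (𝓞 K)) ≤ Q → P ≤ Q) := by
    intro P hP hle hu
    have h1 : algebraMap (𝓞 F) (𝓞 K) (c ^ 2 - c + m) ∈ P := hle (Ideal.mem_map_of_mem _ hc)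
    have h3 : (α - algebraMap (𝓞 F) (𝓞 K) c) * (α - algebraMap (𝓞 F) (𝓞 K) (1 - c)) ∈ P := by
      have : (α - algebraMap (𝓞 F) (𝓞 K) c) * (α - algebraMap (𝓞 F) (𝓞 K) (1 - c)) =
          - algebraMap (𝓞 F) (𝓞 K) (c ^ 2 - c + m) := by
        simp only [map_sub, map_add, map_pow, map_one, map_natCast]
        linear_combination hα
      rw [this]; exact P.neg_mem h1
    rcases hP.mem_or_mem h3 with h | h
    · exact no_unique p m hm α hα hαF h2 q hq hq0 hpq c P hP hle hu h
    · exact no_unique p m hm α hα hαF h2 q hq hq0 hpq _ P hP hle hu h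
  rcases trichotomy h2 q hq hq0 with h | ⟨P, Q, hP, hQ, hI, -, -⟩
  · exact absurd (fun Q _ hQ => hQ) (key _ h le_rfl)
  · refine ⟨P, Q, hP, hQ, ?_, hI⟩
    rintro rfl
    refine key P hP (hI ▸ Ideal.mul_le_left) fun Q hQ hle => ?_
    rw [hI] at hle
    rcases hQ.mul_le.mp hle with h | h <;> exact h

lemma inert_of_no_root (m : ℕ)
    (α : 𝓞 K) (hα : α ^ 2 - α + m = 0)
    (h2 : Module.finrank F K = 2) (q : Ideal (𝓞 F)) (hq : q.IsPrime)
    (hq0 : q ≠ ⊥) (hc : ∀ c : 𝓞 F, c ^ 2 - c + m ∉ q) :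
    (q.map (algebraMap (𝓞 F) (𝓞 K))).IsPrime := by
  rcases trichotomy h2 q hq hq0 with h | ⟨P, Q, hP, hQ, hI, hN, -⟩
  · exact h
  · exfalso
    have hle : q.map (algebraMap (𝓞 F) (𝓞 K)) ≤ P := hI ▸ Ideal.mul_le_left
    obtain ⟨c, hcP⟩ := (absNorm_le q hq hq0 P hP hle).2 hN α
    apply hc c
    rw [← comap_eq_of_le q hq hq0 P hP hle, Ideal.mem_comap]
    have : algebraMap (𝓞 F) (𝓞 K) (c ^ 2 - c + m) =
        (1 - α - algebraMap (𝓞 F) (𝓞 K) c) * (α - algebraMap (𝓞 F) (𝓞 K) c) := by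
      simp only [map_sub, map_add, map_pow, map_natCast]
      linear_combination hα
    rw [this]; exact P.mul_mem_left _ hcP

lemma ram_of_p (p m : ℕ) (hm : 4 * m = p + 1)
    (α : 𝓞 K) (hα : α ^ 2 - α + m = 0)
    (h2 : Module.finrank F K = 2) (hp : p ≠ 0)
    (hq : (Ideal.span {(p : 𝓞 F)}).IsPrime) :
    ∃ P : Ideal (𝓞 K), P.IsPrime ∧
      (Ideal.span {(p : 𝓞 F)}).map (algebraMap (𝓞 F) (𝓞 K)) = P ^ 2 := by
  have hq0 : Ideal.span {(p : 𝓞 F)} ≠ ⊥ := by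
    rw [Ne, Ideal.span_singleton_eq_bot]; exact_mod_cast hp
  have hmk : (4 : 𝓞 K) * m = p + 1 := by exact_mod_cast congrArg (Nat.cast : ℕ → 𝓞 K) hm
  have hs : (2 * α - 1) * (2 * α - 1) = - (p : 𝓞 K) := by linear_combination 4 * hα - hmk
  set S : Ideal (𝓞 K) := Ideal.span {2 * α - 1} with hS
  have hI : (Ideal.span {(p : 𝓞 F)}).map (algebraMap (𝓞 F) (𝓞 K)) = S * S := by
    rw [Ideal.map_span, Set.image_singleton, hS, Ideal.span_singleton_mul_span_singleton, hs,
      Ideal.span_singleton_neg, map_natCast]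
  have hI0 := map_ne_bot' (K := K) _ hq0
  have hS0 : S ≠ 0 := by rintro h; rw [hI, h] at hI0; simp at hI0
  have htri := trichotomy h2 _ hq hq0
  have hnd : ¬ S * S ∣ S := by
    intro h
    have hu : IsUnit S := by
      obtain ⟨J, hJ⟩ := h
      refine IsUnit.of_mul_eq_one J (mul_left_cancel₀ hS0 ?_)
      rw [← mul_assoc, ← hJ, mul_one]
    have hS1 : S = ⊤ := by rwa [Ideal.isUnit_iff] at hu
    rcases htri with h | ⟨P, Q, hP, hQ, hPQ, -, -⟩
    · apply h.ne_top; rw [hI, hS1, Ideal.mul_top]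
    · apply hP.ne_top
      rw [hI, hS1, Ideal.mul_top] at hPQ
      exact top_le_iff.mp (hPQ.le.trans Ideal.mul_le_left)
  rcases htri with h | ⟨P, Q, hP, hQ, hPQ, -, -⟩
  · exfalso
    rw [hI] at h
    apply hnd
    rw [Ideal.dvd_iff_le]
    rcases h.mul_le.mp le_rfl with h | h <;> exact h
  · refine ⟨P, hP, ?_⟩
    rw [hPQ, sq]
    congr 1
    by_contra hne
    apply hnd
    rw [hI] at hPQ
    have hP1 : P ∣ S := by
      rw [Ideal.dvd_iff_le]
      rcases hP.mul_le.mp (hPQ.le.trans Ideal.mul_le_left) with h | h <;> exact h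
    have hQ1 : Q ∣ S := by
      rw [Ideal.dvd_iff_le]
      rcases hQ.mul_le.mp (hPQ.le.trans Ideal.mul_le_right) with h | h <;> exact h
    rw [hPQ]
    have hSS0 : S * S ≠ 0 := mul_ne_zero hS0 hS0
    have hP0 : P ≠ ⊥ := by rintro rfl; apply hSS0; rw [hPQ]; simp
    have hQ0 : Q ≠ ⊥ := by rintro rfl; apply hSS0; rw [hPQ]; simp
    have hPm := hP.isMaximal hP0
    have hQm := hQ.isMaximal hQ0
    apply IsCoprime.mul_dvd _ hP1 hQ1
    rw [Ideal.isCoprime_iff_sup_eq]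
    exact hPm.coprime_of_ne hQm (Ne.symm hne)

lemma root_iff (p m : ℕ) [Fact p.Prime] (hp4 : p % 4 = 3) (hm : 4 * m = p + 1) (q : Ideal (𝓞 F))
    (hq : q.IsPrime) (hq0 : q ≠ ⊥) (hpq : (p : 𝓞 F) ∉ q) :
    (∃ c : 𝓞 F, c ^ 2 - c + m ∈ q) ↔ legendreSym p (Ideal.absNorm q : ℤ) = 1 := by
  have hqm : q.IsMaximal := hq.isMaximal hq0
  let : Field (𝓞 F ⧸ q) := Ideal.Quotient.field q
  have := quot_finite q hq0
  let : Fintype (𝓞 F ⧸ q) := Fintype.ofFinite _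
  have hpk : (p : 𝓞 F ⧸ q) ≠ 0 := by
    intro h; apply hpq
    rw [← Ideal.Quotient.eq_zero_iff_mem]; simpa using h
  rw [absNorm_card, Nat.card_eq_fintype_card, ← ff_main p m hp4 hm hpk]
  constructor
  · rintro ⟨c, hc⟩
    rw [← Ideal.Quotient.eq_zero_iff_mem] at hc
    exact ⟨Ideal.Quotient.mk q c, by simpa using hc⟩
  · rintro ⟨y, hy⟩
    obtain ⟨c, rfl⟩ := Ideal.Quotient.mk_surjective y
    exact ⟨c, by rw [← Ideal.Quotient.eq_zero_iff_mem]; simpa using hy⟩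

lemma chi_eq (p m : ℕ)
    (α : 𝓞 K) (hα : α ^ 2 - α + m = 0) (hαF : ∀ x : F, algebraMap F K x ≠ α)
    [Fact p.Prime] (hp4 : p % 4 = 3) (hm : 4 * m = p + 1)
    (h2 : Module.finrank F K = 2) (hinert : (Ideal.span {(p : 𝓞 F)}).IsPrime)
    (χ : Ideal (𝓞 F) → ℤ)
    (hχmul : ∀ I J : Ideal (𝓞 F), I ≠ ⊥ → J ≠ ⊥ → χ (I * J) = χ I * χ J)
    (hχsplit : ∀ 𝔮 : Ideal (𝓞 F), 𝔮.IsPrime → 𝔮 ≠ ⊥ →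
      (∃ P Q : Ideal (𝓞 K), P.IsPrime ∧ Q.IsPrime ∧ P ≠ Q ∧
        Ideal.map (algebraMap (𝓞 F) (𝓞 K)) 𝔮 = P * Q) → χ 𝔮 = 1)
    (hχinert : ∀ 𝔮 : Ideal (𝓞 F), 𝔮.IsPrime → 𝔮 ≠ ⊥ →
      (Ideal.map (algebraMap (𝓞 F) (𝓞 K)) 𝔮).IsPrime → χ 𝔮 = -1)
    (hχram : ∀ 𝔮 : Ideal (𝓞 F), 𝔮.IsPrime → 𝔮 ≠ ⊥ →
      (∃ P : Ideal (𝓞 K), P.IsPrime ∧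
        Ideal.map (algebraMap (𝓞 F) (𝓞 K)) 𝔮 = P ^ 2) → χ 𝔮 = 0)
    (I : Ideal (𝓞 F)) (hI : I ≠ ⊥) : χ I = legendreSym p (Ideal.absNorm I : ℤ) := by
  have hp0 : p ≠ 0 := by omega
  have hprime : ∀ q : Ideal (𝓞 F), q.IsPrime → q ≠ ⊥ →
      χ q = legendreSym p (Ideal.absNorm q : ℤ) ∧ ((p : 𝓞 F) ∉ q → χ q ≠ 0) := by
    intro q hq hq0
    by_cases hpq : (p : 𝓞 F) ∈ q
    · have hs0 : Ideal.span {(p : 𝓞 F)} ≠ ⊥ := by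
        rw [Ne, Ideal.span_singleton_eq_bot]; exact_mod_cast hp0
      have : Ideal.span {(p : 𝓞 F)} = q :=
        (hinert.isMaximal hs0).eq_of_le hq.ne_top ((Ideal.span_singleton_le_iff_mem _).mpr hpq)
      subst this
      refine ⟨?_, fun h => absurd hpq h⟩
      rw [hχram _ hq hq0 (ram_of_p p m hm α hα h2 hp0 hinert), Ideal.absNorm_span_natCast]
      symm
      rw [legendreSym.eq_zero_iff]
      push_cast
      rw [ZMod.natCast_self, zero_pow]
      exact Module.finrank_pos.ne'
    · by_cases hr : ∃ c : 𝓞 F, c ^ 2 - c + m ∈ q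
      · have h1 := (root_iff p m hp4 hm q hq hq0 hpq).mp hr
        obtain ⟨c, hc⟩ := hr
        rw [hχsplit q hq hq0 (split_of_root p m hm α hα hαF h2 q hq hq0 hpq c hc), h1]
        simp
      · have h1 := mt (root_iff p m hp4 hm q hq hq0 hpq).mpr hr
        push Not at hr
        rw [hχinert q hq hq0 (inert_of_no_root m α hα h2 q hq hq0 hr)]
        refine ⟨?_, by simp⟩
        have hz : ((Ideal.absNorm q : ℤ) : ZMod p) ≠ 0 := by
          intro h
          rw [Int.cast_natCast, ZMod.natCast_eq_zero_iff] at h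
          have hmem := Ideal.absNorm_mem q
          obtain ⟨t, ht⟩ := id h
          have hqm : q.IsMaximal := hq.isMaximal hq0
          let : Field (𝓞 F ⧸ q) := Ideal.Quotient.field q
          have := quot_finite q hq0
          let : Fintype (𝓞 F ⧸ q) := Fintype.ofFinite _
          rw [absNorm_card, Nat.card_eq_fintype_card] at h
          obtain ⟨n, hl, hn⟩ := FiniteField.card (𝓞 F ⧸ q) (ringChar (𝓞 F ⧸ q))
          rw [hn] at h
          have h5 := (Nat.prime_dvd_prime_iff_eq Fact.out hl).mp (Nat.Prime.dvd_of_dvd_pow Fact.out h)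
          apply hpq
          rw [← Ideal.Quotient.eq_zero_iff_mem, map_natCast, h5]
          exact ringChar.Nat.cast_ringChar
        rcases legendreSym.eq_one_or_neg_one p hz with h | h
        · exact absurd h h1
        · exact h.symm
  have htop : χ ⊤ = 1 := by
    have h2t : Ideal.span {(2 : 𝓞 F)} ≠ ⊤ := by
      intro h
      have h1 := Ideal.absNorm_span_natCast (S := 𝓞 F) 2
      push_cast at h1
      rw [h, Ideal.absNorm_top] at h1
      have : Module.finrank ℤ (𝓞 F) ≠ 0 := Module.finrank_pos.ne'
      have := Nat.one_lt_two_pow this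
      omega
    obtain ⟨q, hq, hle⟩ := Ideal.exists_le_maximal _ h2t
    have h2q : (2 : 𝓞 F) ∈ q := hle (Ideal.mem_span_singleton_self _)
    have hq0 : q ≠ ⊥ := by
      rintro rfl; simp at h2q
    have hpq : (p : 𝓞 F) ∉ q := by
      intro h
      apply hq.ne_top
      rw [Ideal.eq_top_iff_one]
      have e : p = 2 * (p / 2) + 1 := by omega
      have e2 : (1 : 𝓞 F) = p - (p / 2 : ℕ) * 2 := by
        rw [eq_sub_iff_add_eq]
        have := congrArg (Nat.cast : ℕ → 𝓞 F) e
        rw [this]; push_cast; ring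
      rw [e2]
      exact q.sub_mem h (q.mul_mem_left _ h2q)
    have h3 := (hprime q hq.isPrime hq0).2 hpq
    have h4 := hχmul q ⊤ hq0 top_ne_bot
    rw [Ideal.mul_top] at h4
    exact mul_left_cancel₀ h3 (by rw [← h4, mul_one])
  induction I using UniqueFactorizationMonoid.induction_on_prime with
  | h₁ => exact absurd rfl hI
  | h₂ x hx => 
    rw [Ideal.isUnit_iff] at hx
    rw [hx, htop, Ideal.absNorm_top]; simp
  | h₃ a q ha hq ih =>
    have hq0 : q ≠ ⊥ := hq.ne_zero
    rw [hχmul q a hq0 ha, ih ha, (hprime q (Ideal.isPrime_of_prime hq) hq0).1, map_mul]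
    push_cast
    rw [legendreSym.mul]
end abstractpart

section concrete

lemma finrank_adjoin_two {k E : Type*} [Field k] [Field E] [Algebra k E] (x : E) (a : k)
    (hx : x ^ 2 = algebraMap k E a) (hn : ∀ y : k, algebraMap k E y ≠ x) :
    Module.finrank k k⟮x⟯ = 2 := by
  have hmon : (Polynomial.X ^ 2 - Polynomial.C a : Polynomial k).Monic :=
    Polynomial.monic_X_pow_sub_C a (by norm_num)
  have hroot : Polynomial.aeval x (Polynomial.X ^ 2 - Polynomial.C a : Polynomial k) = 0 := by
    simp [hx]
  have hint : IsIntegral k x := ⟨_, hmon, hroot⟩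
  rw [IntermediateField.adjoin.finrank hint]
  have h1 : (minpoly k x).natDegree ≤ 2 := by
    have := Polynomial.natDegree_le_of_dvd (minpoly.dvd k x hroot) hmon.ne_zero
    simpa using this
  have h2 : 0 < (minpoly k x).natDegree := minpoly.natDegree_pos hint
  have h3 : (minpoly k x).natDegree ≠ 1 := by
    rw [Ne, minpoly.natDegree_eq_one_iff]
    rintro ⟨y, hy⟩; exact hn y hy
  omega

lemma im_zero (d : ℕ) (F : IntermediateField ℚ ℂ) (hF : F = ℚ⟮((Real.sqrt d : ℝ) : ℂ)⟯) (x : ℂ)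
    (hx : x ∈ F) : x.im = 0 := by
  have : F ≤ (IsScalarTower.toAlgHom ℚ ℝ ℂ).fieldRange := by
    rw [hF, IntermediateField.adjoin_le_iff]
    rintro _ rfl
    exact ⟨Real.sqrt d, rfl⟩
  obtain ⟨y, hy⟩ := this hx
  rw [← hy]; exact Complex.ofReal_im y

lemma finrank_F (d : ℕ) (F : IntermediateField ℚ ℂ) (hF : F = ℚ⟮((Real.sqrt d : ℝ) : ℂ)⟯)
    (hd : ¬ IsSquare d) : Module.finrank ℚ F = 2 := by
  subst hF
  apply finrank_adjoin_two _ (d : ℚ)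
  · rw [← Complex.ofReal_pow, Real.sq_sqrt (by positivity)]; simp
  · intro y hy
    have hirr := irrational_sqrt_natCast_iff.mpr hd
    apply hirr
    refine ⟨y, ?_⟩
    have : ((y : ℝ) : ℂ) = ((Real.sqrt d : ℝ) : ℂ) := by rw [← hy]; simp
    exact_mod_cast this

lemma finrank_K (d p : ℕ) (hp : 0 < p) (F K : IntermediateField ℚ ℂ)
    (hF : F = ℚ⟮((Real.sqrt d : ℝ) : ℂ)⟯) (hFK : F ≤ K)
    (hK : K = IntermediateField.adjoin ℚ
      {((Real.sqrt d : ℝ) : ℂ), Complex.I * ((Real.sqrt p : ℝ) : ℂ)}) :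
    @Module.finrank F K _ _ (IntermediateField.inclusion hFK).toRingHom.toAlgebra.toModule = 2 := by
  let : Algebra F K := (IntermediateField.inclusion hFK).toRingHom.toAlgebra
  have hmap : ∀ x : F, ((algebraMap F K x : K) : ℂ) = x := fun x => rfl
  have hsK : Complex.I * ((Real.sqrt p : ℝ) : ℂ) ∈ K := by
    rw [hK]; exact IntermediateField.subset_adjoin _ _ (by simp)
  have hdF : ((Real.sqrt d : ℝ) : ℂ) ∈ F := by
    rw [hF]; exact IntermediateField.mem_adjoin_simple_self _ _
  let s : K := ⟨_, hsK⟩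
  have : IsScalarTower ℚ F K := IsScalarTower.of_algebraMap_eq (fun x => by ext; simp)
  have h1 : Module.finrank F F⟮s⟯ = 2 := by
    apply finrank_adjoin_two s (-(p : F))
    · ext
      rw [hmap]
      push_cast
      rw [mul_pow, Complex.I_sq, ← Complex.ofReal_pow, Real.sq_sqrt (by positivity)]; simp
    · intro y hy
      have h3 := im_zero d F hF y y.2
      have h4 : ((algebraMap F K y : K) : ℂ) = s := by rw [hy]
      rw [hmap] at h4
      rw [h4] at h3
      simp [s] at h3
      omega
  have h2 : F⟮s⟯ = ⊤ := by
    rw [eq_top_iff]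
    intro z _
    have hle : K ≤ (F⟮s⟯.restrictScalars ℚ).map K.val := by
      conv_lhs => rw [hK]
      rw [IntermediateField.adjoin_le_iff]
      rintro x (rfl | rfl)
      · exact ⟨algebraMap F K ⟨_, hdF⟩, F⟮s⟯.algebraMap_mem ⟨_, hdF⟩, rfl⟩
      · exact ⟨s, IntermediateField.mem_adjoin_simple_self F s, rfl⟩
    obtain ⟨w, hw, hwz⟩ := hle z.2
    have : w = z := Subtype.ext hwz
    rw [← this]; exact hw
  rw [h2, IntermediateField.finrank_top'] at h1
  exact h1

lemma norm_trace {F : Type*} [Field F] [CharZero F] [Algebra ℚ F] (b : Module.Basis (Fin 2) ℚ F) (e : F)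
    (h0 : b 0 = 1) (h1 : b 1 = e) (T : ℤ) (he : e ^ 2 - T * e + 1 = 0) (a c : ℚ) (x : F)
    (hx : x = a + c * e) :
    Algebra.norm ℚ x = a ^ 2 + a * c * T + c ^ 2 ∧ Algebra.trace ℚ F x = 2 * a + c * T := by
  have hM : Algebra.leftMulMatrix b x = !![a, -c; c, a + c * T] := by
    have e0 : x * b 0 = a • b 0 + c • b 1 := by
      rw [h0, h1, hx, Algebra.smul_def, Algebra.smul_def, eq_ratCast, eq_ratCast]; ring
    have e1 : x * b 1 = (-c) • b 0 + (a + c * T) • b 1 := by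
      rw [h0, h1, hx, Algebra.smul_def, Algebra.smul_def, eq_ratCast, eq_ratCast]; push_cast
      linear_combination (c : F) * he
    ext i j
    rw [Algebra.leftMulMatrix_eq_repr_mul]
    fin_cases j
    · simp only [Fin.zero_eta, Fin.isValue]
      rw [e0]
      fin_cases i <;> simp
    · simp only [Fin.mk_one, Fin.isValue]
      rw [e1]
      fin_cases i <;> simp
  constructor
  · rw [Algebra.norm_eq_matrix_det b, hM, Matrix.det_fin_two_of]; ring
  · rw [Algebra.trace_eq_matrix_trace b, hM, Matrix.trace_fin_two_of]; ring

lemma eps_irrational (ε : ℝ) (hε1 : 1 < ε) (T : ℤ) (hT : ε ^ 2 - (T : ℝ) * ε + 1 = 0) (x : ℚ) :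
    (x : ℝ) ≠ ε := by
  intro h
  rw [← h] at hT hε1
  have hT' : x ^ 2 - T * x + 1 = 0 := by exact_mod_cast hT
  have hx1 : 1 < x := by exact_mod_cast hε1
  have hint : IsIntegral ℤ x := by
    refine ⟨Polynomial.X ^ 2 - (T : Polynomial ℤ) * Polynomial.X + 1, by monicity!, ?_⟩
    rw [← Polynomial.C_eq_intCast]
    simp only [Polynomial.eval₂_add, Polynomial.eval₂_sub, Polynomial.eval₂_mul,
      Polynomial.eval₂_X_pow, Polynomial.eval₂_X, Polynomial.eval₂_one, Polynomial.eval₂_C]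
    simpa using hT'
  obtain ⟨n, hn⟩ := IsIntegrallyClosed.isIntegral_iff.mp hint
  have hn' : (n : ℚ) = x := by simpa using hn
  rw [← hn'] at hT' hx1
  have h1 : n ^ 2 - T * n + 1 = 0 := by exact_mod_cast hT'
  have h2 : 1 < n := by exact_mod_cast hx1
  have h3 : n ∣ 1 := ⟨T - n, by linear_combination h1⟩
  have := Int.le_of_dvd one_pos h3
  omega

lemma exists_basis (F : IntermediateField ℚ ℂ) (h2 : Module.finrank ℚ F = 2) (e : F) (ε : ℝ)
    (he : (e : ℂ) = ε) (hirr : ∀ x : ℚ, (x : ℝ) ≠ ε) :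
    ∃ b : Module.Basis (Fin 2) ℚ F, b 0 = 1 ∧ b 1 = e := by
  have hli : LinearIndependent ℚ ![(1 : F), e] := by
    rw [LinearIndependent.pair_iff' one_ne_zero]
    intro a ha
    apply hirr a
    have : ((a • (1 : F) : F) : ℂ) = ε := by rw [ha, he]
    rw [Rat.smul_one_eq_cast] at this
    have h3 : ((a : ℝ) : ℂ) = (ε : ℂ) := by rw [← this]; simp
    exact_mod_cast h3
  refine ⟨basisOfLinearIndependentOfCardEqFinrank hli (by simp [h2]), ?_, ?_⟩ <;> simp

lemma idealOf_eq (F : IntermediateField ℚ ℂ) [NumberField F] (v : ℂ) (y : 𝓞 F)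
    (hy : ((y : F) : ℂ) = v) : idealOf F v = Ideal.span {y} := by
  unfold idealOf
  congr 1
  ext z
  simp only [Set.mem_ofPred_eq, Set.mem_singleton_iff]
  constructor
  · intro hz
    apply RingOfIntegers.ext
    apply Subtype.ext
    rw [hz, hy]
  · rintro rfl; exact hy

lemma step (p : ℕ) [Fact p.Prime] (F : IntermediateField ℚ ℂ) [NumberField F]
    (h2 : Module.finrank ℚ F = 2) (ε : ℝ)
    (hεunit : ∃ u : (𝓞 F)ˣ, (((u : 𝓞 F) : F) : ℂ) = (ε : ℂ))
    (hε1 : 1 < ε) (T : ℤ) (hT : ε ^ 2 - (T : ℝ) * ε + 1 = 0) (r : ℚ × ℚ)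
    (hr : inShintani F p ε r) :
    inShintani F p ε (shintaniAct T r) ∧
    idealOf F ((p : ℂ) * ((r.1 : ℂ) + (r.2 : ℂ) * (ε : ℂ))) ≠ ⊥ ∧
    legendreSym p (Ideal.absNorm (idealOf F ((p : ℂ) * (((shintaniAct T r).1 : ℂ) +
      ((shintaniAct T r).2 : ℂ) * (ε : ℂ)))) : ℤ) =
    legendreSym p (Ideal.absNorm (idealOf F ((p : ℂ) * ((r.1 : ℂ) + (r.2 : ℂ) * (ε : ℂ)))) : ℤ) := by
  obtain ⟨u, hu⟩ := hεunit
  obtain ⟨r1, r2⟩ := r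
  obtain ⟨ha, hb, hc, hd, y, hy⟩ := hr
  simp only at ha hb hc hd hy ⊢
  have hp : 0 < p := (Fact.out : p.Prime).pos
  have hTpos : 0 < T := by
    have : 0 < (T : ℝ) := by nlinarith
    exact_mod_cast this
  have hTC : (ε : ℂ) ^ 2 - T * ε + 1 = 0 := by exact_mod_cast congrArg (Complex.ofReal) hT
  set n : ℤ := ⌊r1 + r2 * (T : ℚ)⌋ with hn
  have hact : shintaniAct T (r1, r2) = (1 - r2, r1 + r2 * T - n) := rfl
  have hf0 : 0 ≤ r1 + r2 * (T : ℚ) - n := Int.fract_nonneg _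
  have hf1 : r1 + r2 * (T : ℚ) - n < 1 := Int.fract_lt_one _
  rw [hact]
  simp only
  set e : F := ((u : 𝓞 F) : F) with he
  have heC : e ^ 2 - T * e + 1 = 0 := by
    apply Subtype.ext
    push_cast
    rw [hu]; exact hTC
  obtain ⟨b, hb0, hb1⟩ := exists_basis F h2 e ε hu (eps_irrational ε hε1 T hT)
  let y' : 𝓞 F := u * y + p - p * n * u
  have hy' : ((y' : F) : ℂ) = (p : ℂ) * (((1 - r2 : ℚ) : ℂ) + ((r1 + r2 * T - n : ℚ) : ℂ) * (ε : ℂ)) := by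
    have : (y' : F) = e * y + p - p * n * e := by simp [y', he]
    rw [this]
    push_cast
    rw [hu, hy]
    linear_combination (p : ℂ) * r2 * hTC
  have hyF : (y : F) = ((p * r1 : ℚ) : F) + ((p * r2 : ℚ) : F) * e := by
    apply Subtype.ext
    push_cast
    rw [hu, hy]; ring
  have hyF' : (y' : F) = ((p * (1 - r2) : ℚ) : F) + ((p * (r1 + r2 * T - n) : ℚ) : F) * e := by
    apply Subtype.ext
    push_cast
    rw [hu, hy']; push_cast; ring
  have huyF : ((u * y : 𝓞 F) : F) = ((- (p * r2) : ℚ) : F) + ((p * (r1 + r2 * T) : ℚ) : F) * e := by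
    have h3 : ((u * y : 𝓞 F) : F) = e * (y : F) := by simp [he]
    rw [h3, hyF]
    push_cast
    linear_combination (p : F) * r2 * heC
  have N1 := norm_trace b e hb0 hb1 T heC _ _ _ hyF
  have N2 := norm_trace b e hb0 hb1 T heC _ _ _ hyF'
  have N3 := norm_trace b e hb0 hb1 T heC _ _ _ huyF
  rw [← Algebra.coe_norm_int, ← Algebra.coe_trace_int] at N1 N2 N3
  have hpQ : (0 : ℚ) < p := by exact_mod_cast hp
  have hTQ : (0 : ℚ) < T := by exact_mod_cast hTpos
  have pos1 : 0 < Algebra.norm ℤ y := by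
    have : (0 : ℚ) < (Algebra.norm ℤ y : ℤ) := by rw [N1.1]; positivity
    exact_mod_cast this
  have pos2 : 0 < Algebra.norm ℤ y' := by
    have : (0 : ℚ) < (Algebra.norm ℤ y' : ℤ) := by
      rw [N2.1]
      have : 0 < 1 - r2 := by linarith
      positivity
    exact_mod_cast this
  have hcong : Algebra.norm ℤ y' = Algebra.norm ℤ y + p * (p + Algebra.trace ℤ (𝓞 F) (u * y)
      - n * p * T + p * n ^ 2 - n * Algebra.trace ℤ (𝓞 F) y) := by
    have : ((Algebra.norm ℤ y' : ℤ) : ℚ) = ((Algebra.norm ℤ y + p * (p + Algebra.trace ℤ (𝓞 F) (u * y)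
      - n * p * T + p * n ^ 2 - n * Algebra.trace ℤ (𝓞 F) y) : ℤ) : ℚ) := by
      push_cast
      rw [N1.1, N2.1, N1.2, N3.2]
      ring
    exact_mod_cast this
  rw [idealOf_eq F _ y hy, idealOf_eq F _ y' hy']
  refine ⟨⟨by simpa using hd, by simpa using hc, hf0, hf1, y', hy'⟩, ?_, ?_⟩
  · rw [Ne, Ideal.span_singleton_eq_bot]
    rintro rfl
    simp at pos1
  · rw [Ideal.absNorm_span_singleton, Ideal.absNorm_span_singleton, Int.natAbs_of_nonneg pos1.le,
      Int.natAbs_of_nonneg pos2.le, legendreSym.mod, legendreSym.mod p (Algebra.norm ℤ y), hcong,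
      Int.add_mul_emod_self_left]

end concrete

/-- The quadratic Hecke character `χ` of `K/F` of conductor `pO_F` is
constant along Shintani cycles: `χ((p·(ε_F^i ∗ r))O_F) = χ((p·r)O_F)` for all
`r ∈ R_{F,p}` and `i ≥ 0`. -/
theorem hecke_character_constant_on_shintani_cycles
    (d p : ℕ) (hd1 : 1 < d) (hdsq : Squarefree d)
    (F K : IntermediateField ℚ ℂ) [NumberField F] [NumberField K]
    (hF : F = ℚ⟮((Real.sqrt d : ℝ) : ℂ)⟯)
    (hFK : F ≤ K)
    (hK : K = IntermediateField.adjoin ℚ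
      {((Real.sqrt d : ℝ) : ℂ), Complex.I * ((Real.sqrt p : ℝ) : ℂ)})
    (hhF : NumberField.classNumber F = 1)
    [Fact p.Prime] (hp7 : 7 ≤ p) (hp4 : p % 4 = 3)
    (hleg : legendreSym p (d : ℤ) = -1)
    (hinert : (Ideal.span {(p : 𝓞 F)}).IsPrime)
    -- `ε` is the totally positive fundamental unit of `O_F`
    (ε : ℝ)
    (hεunit : ∃ u : (𝓞 F)ˣ, (((u : 𝓞 F) : F) : ℂ) = (ε : ℂ))
    (hε1 : 1 < ε)
    (Tε : ℤ) (hTε : ε ^ 2 - (Tε : ℝ) * ε + 1 = 0)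
    (hεfund : ∀ x : ℝ, 0 < x → 1 < x →
      (∃ u : (𝓞 F)ˣ, (((u : 𝓞 F) : F) : ℂ) = (x : ℂ)) →
      (∃ T : ℤ, x ^ 2 - (T : ℝ) * x + 1 = 0) → ε ≤ x)
    -- `χ` is the quadratic Hecke character of `K/F` of conductor `pO_F`:
    (χ : Ideal (𝓞 F) → ℤ)
    (hχmul : ∀ I J : Ideal (𝓞 F), I ≠ ⊥ → J ≠ ⊥ → χ (I * J) = χ I * χ J)
    (hχsplit : ∀ 𝔮 : Ideal (𝓞 F), 𝔮.IsPrime → 𝔮 ≠ ⊥ →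
      (∃ P Q : Ideal (𝓞 K), P.IsPrime ∧ Q.IsPrime ∧ P ≠ Q ∧
        Ideal.map (NumberField.RingOfIntegers.mapRingHom
          (IntermediateField.inclusion hFK)) 𝔮 = P * Q) → χ 𝔮 = 1)
    (hχinert : ∀ 𝔮 : Ideal (𝓞 F), 𝔮.IsPrime → 𝔮 ≠ ⊥ →
      (Ideal.map (NumberField.RingOfIntegers.mapRingHom (L := K)
        (IntermediateField.inclusion hFK)) 𝔮).IsPrime → χ 𝔮 = -1)
    (hχram : ∀ 𝔮 : Ideal (𝓞 F), 𝔮.IsPrime → 𝔮 ≠ ⊥ →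
      (∃ P : Ideal (𝓞 K), P.IsPrime ∧
        Ideal.map (NumberField.RingOfIntegers.mapRingHom
          (IntermediateField.inclusion hFK)) 𝔮 = P ^ 2) → χ 𝔮 = 0) :
    ∀ r : ℚ × ℚ, inShintani F p ε r → ∀ i : ℕ,
      χ (idealOf F ((p : ℂ) * ((((shintaniAct Tε)^[i] r).1 : ℂ) +
          (((shintaniAct Tε)^[i] r).2 : ℂ) * (ε : ℂ)))) =
        χ (idealOf F ((p : ℂ) * ((r.1 : ℂ) + (r.2 : ℂ) * (ε : ℂ)))) := by
  intro r hr
  have hp : 0 < p := by omega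
  have hdns : ¬ IsSquare d := by
    rintro ⟨t, rfl⟩
    rw [legendreSym.eq_neg_one_iff] at hleg
    apply hleg
    exact ⟨t, by push_cast; ring⟩
  have hF2 : Module.finrank ℚ F = 2 := finrank_F d F hF hdns
  let : Algebra F K := (IntermediateField.inclusion hFK).toRingHom.toAlgebra
  have hK2 : Module.finrank F K = 2 := finrank_K d p hp F K hF hFK hK
  obtain ⟨m, hm⟩ : ∃ m, 4 * m = p + 1 := ⟨(p + 1) / 4, by omega⟩
  have hsK : Complex.I * ((Real.sqrt p : ℝ) : ℂ) ∈ K := by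
    rw [hK]; exact IntermediateField.subset_adjoin _ _ (by simp)
  let s : K := ⟨_, hsK⟩
  have hs : s ^ 2 = -(p : K) := by
    ext
    push_cast
    rw [mul_pow, Complex.I_sq, ← Complex.ofReal_pow, Real.sq_sqrt (by positivity)]; simp
  have hmK : (4 : K) * m = p + 1 := by exact_mod_cast congrArg (Nat.cast : ℕ → K) hm
  have ha : ((1 + s) / 2) ^ 2 - (1 + s) / 2 + (m : K) = 0 := by
    linear_combination (1 / 4) * hs + (1 / 4) * hmK
  have hint : IsIntegral ℤ ((1 + s) / 2) := by
    refine ⟨Polynomial.X ^ 2 - Polynomial.X + Polynomial.C (m : ℤ), by monicity!, ?_⟩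
    simpa using ha
  let α : 𝓞 K := ⟨(1 + s) / 2, hint⟩
  have hα : α ^ 2 - α + m = 0 := by
    apply RingOfIntegers.ext
    have h4 : ((α ^ 2 - α + m : 𝓞 K) : K) = (α : K) ^ 2 - (α : K) + m := by simp
    rw [h4]
    exact ha
  have hαF : ∀ x : F, algebraMap F K x ≠ α := by
    intro x hx
    have h3 := im_zero d F hF x x.2
    have h4 : (x : ℂ) = (((1 + s) / 2 : K) : ℂ) := congrArg (Subtype.val) hx
    have h5 : (s : ℂ) = 2 * x - 1 := by
      have h7 : s = 2 * ((1 + s) / 2) - 1 := by ring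
      rw [h4]
      exact congrArg (Subtype.val) h7
    have h6 := congrArg Complex.im h5
    simp [s, h3] at h6
    omega
  have hchi := chi_eq p m α hα hαF hp4 hm hK2 hinert χ hχmul hχsplit hχinert hχram
  have key : ∀ i : ℕ, inShintani F p ε ((shintaniAct Tε)^[i] r) ∧
      χ (idealOf F ((p : ℂ) * ((((shintaniAct Tε)^[i] r).1 : ℂ) +
          (((shintaniAct Tε)^[i] r).2 : ℂ) * (ε : ℂ)))) =
        χ (idealOf F ((p : ℂ) * ((r.1 : ℂ) + (r.2 : ℂ) * (ε : ℂ)))) := by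
    intro i
    induction i with
    | zero => exact ⟨hr, rfl⟩
    | succ i ih =>
      obtain ⟨ih1, ih2⟩ := ih
      rw [Function.iterate_succ_apply']
      obtain ⟨h1, h2, h3⟩ := step p F hF2 ε hεunit hε1 Tε hTε _ ih1
      refine ⟨h1, ?_⟩
      rw [← ih2, hchi _ h2, hchi _ (step p F hF2 ε hεunit hε1 Tε hTε _ h1).2.1, h3]
  exact fun i => (key i).2
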